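/- Let q ∈ 𝕆 be a nonzero octonion and L_q : 𝕆 → 𝕆 the left multiplication operator x ↦ qx on the Banach 𝕆-bimodule 𝕆, whose pull-back spectrum is σ*(L_q) = [q] := {Re q + |Im q|·J : J ∈ 𝕊}. Then for every f left slice regular on a slice-open set containing the closure of some L_q-left-admissible domain and for every J ∈ 𝕊, the octonionic left slice regular functional calculus gives f*(L_q)_J = L_{f(q)}, the left multiplication operator by f(q). -/

import Mathlib

noncomputable section

open scoped BigOperators

/-- Octonions, realized via the Cayley–Dickson doubling of the quaternions. -/
@[ext]
structure Oct : Type where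
  a : Quaternion ℝ
  b : Quaternion ℝ

namespace Oct

instance : Zero Oct := ⟨⟨0, 0⟩⟩
instance : Add Oct := ⟨fun x y => ⟨x.a + y.a, x.b + y.b⟩⟩
instance : Neg Oct := ⟨fun x => ⟨-x.a, -x.b⟩⟩
instance : Sub Oct := ⟨fun x y => ⟨x.a - y.a, x.b - y.b⟩⟩
instance : SMul ℕ Oct := ⟨fun n x => ⟨n • x.a, n • x.b⟩⟩
instance : SMul ℤ Oct := ⟨fun n x => ⟨n • x.a, n • x.b⟩⟩
instance : SMul ℝ Oct := ⟨fun r x => ⟨r • x.a, r • x.b⟩⟩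

def toLp (x : Oct) : WithLp 2 (Quaternion ℝ × Quaternion ℝ) :=
  (WithLp.equiv 2 (Quaternion ℝ × Quaternion ℝ)).symm (x.a, x.b)

lemma toLp_injective : Function.Injective toLp := by
  rintro ⟨xa, xb⟩ ⟨ya, yb⟩ h
  have ha : xa = ya :=
    congrArg (fun z => (WithLp.equiv 2 (Quaternion ℝ × Quaternion ℝ) z).1) h
  have hb : xb = yb :=
    congrArg (fun z => (WithLp.equiv 2 (Quaternion ℝ × Quaternion ℝ) z).2) h
  subst ha; subst hb; rfl

instance : AddCommGroup Oct :=
  toLp_injective.addCommGroup toLp rfl (fun _ _ => rfl) (fun _ => rfl) (fun _ _ => rfl)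
    (fun _ _ => rfl) (fun _ _ => rfl)

def toLpHom : Oct →+ WithLp 2 (Quaternion ℝ × Quaternion ℝ) where
  toFun := toLp
  map_zero' := rfl
  map_add' _ _ := rfl

instance : Module ℝ Oct := toLp_injective.module ℝ toLpHom fun _ _ => rfl

instance : NormedAddCommGroup Oct :=
  NormedAddCommGroup.induced Oct (WithLp 2 (Quaternion ℝ × Quaternion ℝ)) toLpHom toLp_injective

instance : NormedSpace ℝ Oct := ⟨fun r x => norm_smul_le r (toLp x)⟩

def toProdLin : Oct →ₗ[ℝ] Quaternion ℝ × Quaternion ℝ where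
  toFun x := (x.a, x.b)
  map_add' _ _ := rfl
  map_smul' _ _ := rfl

lemma toProdLin_injective : Function.Injective toProdLin := by
  rintro ⟨xa, xb⟩ ⟨ya, yb⟩ h
  have ha : xa = ya := congrArg Prod.fst h
  have hb : xb = yb := congrArg Prod.snd h
  subst ha; subst hb; rfl

instance : FiniteDimensional ℝ Oct :=
  FiniteDimensional.of_injective toProdLin toProdLin_injective

instance : CompleteSpace Oct := FiniteDimensional.complete ℝ Oct

instance : One Oct := ⟨⟨1, 0⟩⟩

instance : Mul Oct :=
  ⟨fun x y => ⟨x.a * y.a - star y.b * x.b, y.b * x.a + x.b * star y.a⟩⟩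

/-- Octonionic conjugation. -/
def conj (x : Oct) : Oct := ⟨star x.a, -x.b⟩

/-- The real part of an octonion. -/
def re (x : Oct) : ℝ := x.a.re

/-- Powers of an octonion (association chosen on the left factor). -/
def opow (s : Oct) : ℕ → Oct
  | 0 => 1
  | n + 1 => s * opow s n

/-- The inverse of a nonzero octonion. -/
def oinv (s : Oct) : Oct := (‖s‖ ^ 2)⁻¹ • conj s

/-- `invPow s n` is the octonion `s ^ (-1 - n)`. -/
def invPow (s : Oct) (n : ℕ) : Oct := opow (oinv s) (n + 1)

def eNat : ℕ → Oct
  | 0 => ⟨1, 0⟩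
  | 1 => ⟨⟨0, 1, 0, 0⟩, 0⟩
  | 2 => ⟨⟨0, 0, 1, 0⟩, 0⟩
  | 3 => ⟨⟨0, 0, 0, 1⟩, 0⟩
  | 4 => ⟨0, 1⟩
  | 5 => ⟨0, ⟨0, 1, 0, 0⟩⟩
  | 6 => ⟨0, ⟨0, 0, 1, 0⟩⟩
  | 7 => ⟨0, ⟨0, 0, 0, 1⟩⟩
  | _ => 0

/-- The standard basis `e_0 = 1, e_1, …, e_7` of the octonions. -/
def e (i : Fin 8) : Oct := eNat i.val

/-- The six-dimensional sphere `𝕊` of imaginary units of `𝕆`. -/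
def unitSphere : Set Oct := {J | J * J = -1}

/-- The slice `ℂ_J = ℝ ⊕ ℝJ` of the octonions. -/
def sliceC (J : Oct) : Set Oct := {s | ∃ x y : ℝ, s = x • (1 : Oct) + y • J}

/-- The embedding of `ℂ` onto the slice `ℂ_J`, `x + y i ↦ x + y J`. -/
def toSlice (J : Oct) (z : ℂ) : Oct := z.re • (1 : Oct) + z.im • J

end Oct

open Oct

/-- A (normed/Banach) `𝕆`-bimodule: a real normed space with continuous real-bilinear left and
right octonionic multiplications satisfying the alternativity relations
`[p,q,x] = [q,x,p] = [x,p,q] = -[q,p,x]` and the norm identities `‖px‖ = |p|‖x‖ = ‖xp‖`. -/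
class OctBimodule (V : Type*) [NormedAddCommGroup V] [NormedSpace ℝ V] : Type _ where
  lm : Oct →ₗ[ℝ] V →L[ℝ] V
  rm : Oct →ₗ[ℝ] V →L[ℝ] V
  lm_one : ∀ x : V, lm 1 x = x
  rm_one : ∀ x : V, rm 1 x = x
  /-- `[p,q,x] = [q,x,p]` -/
  assoc_cyc₁ : ∀ (p q : Oct) (x : V),
    lm (p * q) x - lm p (lm q x) = rm p (lm q x) - lm q (rm p x)
  /-- `[p,q,x] = [x,p,q]` -/
  assoc_cyc₂ : ∀ (p q : Oct) (x : V),
    lm (p * q) x - lm p (lm q x) = rm q (rm p x) - rm (p * q) x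
  /-- `[p,q,x] = -[q,p,x]` -/
  assoc_alt : ∀ (p q : Oct) (x : V),
    lm (p * q) x - lm p (lm q x) = -(lm (q * p) x - lm q (lm p x))
  norm_lm : ∀ (p : Oct) (x : V), ‖lm p x‖ = ‖p‖ * ‖x‖
  norm_rm : ∀ (p : Oct) (x : V), ‖rm p x‖ = ‖p‖ * ‖x‖

section OctMod

variable {V : Type*} [NormedAddCommGroup V] [NormedSpace ℝ V] [OctBimodule V]

/-- Left multiplication `x ↦ p x` as a bounded real-linear operator. -/
def lmo (p : Oct) : V →L[ℝ] V := OctBimodule.lm p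

/-- Right multiplication `R_p : x ↦ x p` as a bounded real-linear operator. -/
def rmo (p : Oct) : V →L[ℝ] V := OctBimodule.rm p

variable (V)

/-- The real-part projection `Re x = (5/12) x - (1/12) ∑_{i=1}^7 e_i x e_i` of an
`𝕆`-bimodule. -/
def reO : V →L[ℝ] V :=
  (5 / 12 : ℝ) • ContinuousLinearMap.id ℝ V -
    (1 / 12 : ℝ) • ∑ i : Fin 7, (rmo (e i.succ)).comp (lmo (e i.succ))

/-- The real part `Re V` of an `𝕆`-bimodule, i.e. the set of associative central elements. -/
def ReSet : Set V :=
  {m | (∀ p q : Oct, lmo (p * q) m = lmo p (lmo q m)) ∧ ∀ p : Oct, lmo p m = rmo p m}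

/-- The slice `ℂ_J(V) = Re V ⊕ J · Re V` of an `𝕆`-bimodule. -/
def CJV (J : Oct) : Set V :=
  {x | ∃ u ∈ ReSet V, ∃ w ∈ ReSet V, x = u + lmo J w}

/-- The slice projection `π_J(x) = Re x + J Re (J̄ x)`. -/
def piJ (J : Oct) : V →L[ℝ] V :=
  reO V + (lmo J).comp ((reO V).comp (lmo (Oct.conj J)))

variable {V}

/-- The second right associator `B_p(T, x) = T(x) p - T(x p)` of an operator. -/
def Bop (p : Oct) (T : V →L[ℝ] V) : V →L[ℝ] V := (rmo p).comp T - T.comp (rmo p)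

/-- A bounded real-linear operator is right (octonionic) para-linear if `Re B_p(T,x) = 0`. -/
def IsRightPara (T : V →L[ℝ] V) : Prop := ∀ (p : Oct) (x : V), reO V (Bop p T x) = 0

/-- The left octonionic scalar multiplication `(p ⊙ T)(x) = p T(x) + B_p(T,x)` on operators. -/
def odotL (p : Oct) (T : V →L[ℝ] V) : V →L[ℝ] V := (lmo p).comp T + Bop p T

/-- The right octonionic scalar multiplication `(T ⊙ p)(x) = T(p x) - B_p(T,x)` on operators. -/
def odotR (T : V →L[ℝ] V) (p : Oct) : V →L[ℝ] V := T.comp (lmo p) - Bop p T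

/-- The lifting map, `(lif F)(x) = ∑_i F(x ē_i) e_i`. -/
def lifO (F : V →L[ℝ] V) : V →L[ℝ] V :=
  ∑ i : Fin 8, (rmo (e i)).comp (F.comp (rmo (Oct.conj (e i))))

/-- The extension map, `(ext G)(∑ x_i e_i) = ∑ G(x_i) e_i`, where `x_i = Re (x ē_i)`. -/
def extO (G : V →L[ℝ] V) : V →L[ℝ] V :=
  ∑ i : Fin 8, (rmo (e i)).comp (G.comp ((reO V).comp (rmo (Oct.conj (e i)))))

/-- The left regular power `T^{n⊚} = lif (Re ∘ Tⁿ)`. -/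
def rpowL (T : V →L[ℝ] V) (n : ℕ) : V →L[ℝ] V := lifO ((reO V).comp (T ^ n))

/-- The right regular power `T^{⊚n} = ext (Tⁿ|_{Re V})`. -/
def rpowR (T : V →L[ℝ] V) (n : ℕ) : V →L[ℝ] V := extO (T ^ n)

/-- The regular composition `f ⊚ g = lif (Re ∘ f ∘ g)`. -/
def rcomp (f g : V →L[ℝ] V) : V →L[ℝ] V := lifO ((reO V).comp (f.comp g))

/-- The composition associator `[f,g,x]_⊚ = (f ⊚ g)(x) - f(g(x))`. -/
def compAssoc (f g : V →L[ℝ] V) (x : V) : V := rcomp f g x - f (g x)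

/-- The right regular inverse `T^{⊚-} = ext (T⁻¹|_{Re V})` of an invertible operator. -/
def rinvR (T : V →L[ℝ] V) : V →L[ℝ] V := extO (Ring.inverse T)

/-- The left regular inverse `T^{-⊚} = lif (Re ∘ T⁻¹)` of an invertible operator. -/
def rinvL (T : V →L[ℝ] V) : V →L[ℝ] V := lifO ((reO V).comp (Ring.inverse T))

/-- An operator is power-associative if all of its (composition) powers are right
para-linear. -/
def IsPowerAssoc (T : V →L[ℝ] V) : Prop := ∀ n : ℕ, IsRightPara (T ^ n)

/-- A bounded operator is octonionic linear if `T(xp) = T(x)p` for all `p`. -/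
def IsOctLinear (T : V →L[ℝ] V) : Prop := ∀ (p : Oct) (x : V), T (rmo p x) = rmo p (T x)

/-- `S` is `ℂ_J`-extendable power associative: `Sⁿ(v s) = Sⁿ(v) s` for `v ∈ Re V`,
`s ∈ ℂ_J`, `n ≥ 1`. -/
def CJExtPA (J : Oct) (S : V →L[ℝ] V) : Prop :=
  ∀ n : ℕ, 1 ≤ n → ∀ v ∈ ReSet V, ∀ s ∈ sliceC J, (S ^ n) (rmo s v) = rmo s ((S ^ n) v)

/-- `S` is `ℂ_J`-liftable power associative: `Re (Sⁿ(v s)) = Re (Sⁿ(v) s)` for all `v ∈ V`,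
`s ∈ ℂ_J`, `n ≥ 1`. -/
def CJLiftPA (J : Oct) (S : V →L[ℝ] V) : Prop :=
  ∀ n : ℕ, 1 ≤ n → ∀ (v : V), ∀ s ∈ sliceC J,
    reO V ((S ^ n) (rmo s v)) = reO V (rmo s ((S ^ n) v))

/-- The pull-back slice-resolvent set `ρ*_J(T)`. -/
def pbResSlice (T : V →L[ℝ] V) (J : Oct) : Set Oct :=
  {s | s ∈ sliceC J ∧ IsUnit ((rmo s : V →L[ℝ] V) - T) ∧
    CJExtPA J (Ring.inverse ((rmo s : V →L[ℝ] V) - T))}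

/-- The pull-back resolvent set `ρ*(T)`. -/
def pbRes (T : V →L[ℝ] V) : Set Oct := ⋃ J ∈ unitSphere, pbResSlice T J

/-- The pull-back spectrum `σ*(T) = 𝕆 ∖ ρ*(T)`. -/
def pbSpec (T : V →L[ℝ] V) : Set Oct := Set.univ \ pbRes T

/-- The push-forward slice-resolvent set `ρ_{*J}(T)`. -/
def pfResSlice (T : V →L[ℝ] V) (J : Oct) : Set Oct :=
  {s | s ∈ sliceC J ∧ IsUnit ((rmo s : V →L[ℝ] V) - T) ∧
    CJLiftPA J (Ring.inverse ((rmo s : V →L[ℝ] V) - T))}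

/-- The push-forward resolvent set `ρ_*(T)`. -/
def pfRes (T : V →L[ℝ] V) : Set Oct := ⋃ J ∈ unitSphere, pfResSlice T J

/-- The push-forward spectrum `σ_*(T) = 𝕆 ∖ ρ_*(T)`. -/
def pfSpec (T : V →L[ℝ] V) : Set Oct := Set.univ \ pfRes T

/-- The real-part projection of the `𝕆`-bimodule `𝓑_RO(V)` of bounded right para-linear
operators, given by `Re A = (5/12) A - (1/12) ∑_{i=1}^7 (e_i ⊙ A) ⊙ e_i`. -/
def reOpB (A : V →L[ℝ] V) : V →L[ℝ] V :=
  (5 / 12 : ℝ) • A - (1 / 12 : ℝ) • ∑ i : Fin 7, odotR (odotL (e i.succ) A) (e i.succ)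

end OctMod

/-- A set `U ⊆ 𝕆` is slice-open if `U ∩ ℂ_J` is open in `ℂ_J` for every `J ∈ 𝕊`. -/
def SliceOpen (U : Set Oct) : Prop :=
  ∀ J ∈ unitSphere, IsOpen (Oct.toSlice J ⁻¹' U)

/-- A parametrization of the boundary `∂(U ∩ ℂ_J)` by finitely many continuously
differentiable, positively oriented Jordan curves (positivity of the orientation is encoded
through the winding numbers). -/
structure SliceContour (J : Oct) (U : Set Oct) where
  n : ℕ
  γ : Fin n → ℝ → ℂ
  smooth : ∀ i, ContDiff ℝ 1 (γ i)
  closed : ∀ i, γ i 0 = γ i 1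
  jordan : ∀ i, Set.InjOn (γ i) (Set.Ico (0 : ℝ) 1)
  image_eq : (⋃ i, γ i '' Set.Icc (0 : ℝ) 1) = frontier (Oct.toSlice J ⁻¹' U)
  winding_inside : ∀ z : ℂ, Oct.toSlice J z ∈ U →
    (∑ i, ∫ t in (0 : ℝ)..1, deriv (γ i) t / (γ i t - z)) = 2 * (Real.pi : ℂ) * Complex.I
  winding_outside : ∀ z : ℂ, Oct.toSlice J z ∉ closure U →
    (∑ i, ∫ t in (0 : ℝ)..1, deriv (γ i) t / (γ i t - z)) = 0

/-- The integral `∫_{∂(U ∩ ℂ_J)} Φ(s, ds)` along a slice contour: the integrand gets the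
point of the curve and its derivative (both in the coordinates of the slice). -/
def contourSum {J : Oct} {U : Set Oct} (Γ : SliceContour J U) {E : Type*}
    [NormedAddCommGroup E] [NormedSpace ℝ E] (Φ : ℂ → ℂ → E) : E :=
  ∑ i, ∫ t in (0 : ℝ)..1, Φ (Γ.γ i t) (deriv (Γ.γ i) t)

/-- An axially symmetric slice domain (s-domain) in `𝕆`. -/
structure IsAdmissibleDomain (U : Set Oct) : Prop where
  isOpen : IsOpen U
  isConnected : IsConnected U
  real_nonempty : (U ∩ {s : Oct | ∃ r : ℝ, s = r • (1 : Oct)}).Nonempty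
  axially : ∀ (z : ℂ), ∀ I ∈ unitSphere, ∀ J ∈ unitSphere,
    Oct.toSlice I z ∈ U → Oct.toSlice J z ∈ U
  slice_conn : ∀ J ∈ unitSphere, IsConnected (Oct.toSlice J ⁻¹' U)

section Adm

variable {V : Type*} [NormedAddCommGroup V] [NormedSpace ℝ V] [OctBimodule V]

/-- A `T`-left-admissible domain: an axially symmetric s-domain containing the pull-back
spectrum `σ*(T)`.  (The regularity of its slice boundaries is witnessed by the slice
contours used in the integrals.) -/
def LeftAdmissible (T : V →L[ℝ] V) (U : Set Oct) : Prop :=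
  IsAdmissibleDomain U ∧ pbSpec T ⊆ U

/-- A `T`-right-admissible domain: an axially symmetric s-domain containing the push-forward
spectrum `σ_*(T)`. -/
def RightAdmissible (T : V →L[ℝ] V) (U : Set Oct) : Prop :=
  IsAdmissibleDomain U ∧ pfSpec T ⊆ U

end Adm

/-- The axially symmetric set `Ω_D ⊆ 𝕆` induced by a conjugation-invariant set `D ⊆ ℂ`. -/
def OmegaD (D : Set ℂ) : Set Oct := ⋃ J ∈ unitSphere, Oct.toSlice J '' D

/-- `F` is the stem of a slice preserving slice regular function on `Ω_D`: it is holomorphic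
on the open conjugation-invariant set `D` and intertwines complex conjugation. -/
structure IsStem (D : Set ℂ) (F : ℂ → ℂ) : Prop where
  isOpen : IsOpen D
  conj_mem : ∀ z ∈ D, (starRingEnd ℂ) z ∈ D
  holo : DifferentiableOn ℂ F D
  conj_comm : ∀ z ∈ D, F ((starRingEnd ℂ) z) = (starRingEnd ℂ) (F z)

section FC

variable {V : Type*} [NormedAddCommGroup V] [NormedSpace ℝ V] [OctBimodule V]

/-- The slice integral `(1/2π) ∫_{∂(U∩ℂ_J)} (R_s - T)^{⊚-} ⊙ (ds_J f(s))` defining the left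
slice regular functional calculus of a slice preserving function with stem `F`. -/
def leftFC (T : V →L[ℝ] V) (J : Oct) {U : Set Oct} (Γ : SliceContour J U)
    (F : ℂ → ℂ) : V →L[ℝ] V :=
  (2 * Real.pi)⁻¹ • contourSum Γ fun z dz =>
    odotR (rinvR ((rmo (Oct.toSlice J z) : V →L[ℝ] V) - T))
      ((-(Oct.toSlice J dz) * J) * Oct.toSlice J (F z))

/-- The slice integral `(1/2π) ∫_{∂(U∩ℂ_J)} (f(s) ds_J) ⊙ (R_s - T)^{-⊚}` defining the right
slice regular functional calculus of a slice preserving function with stem `F`. -/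
def rightFC (T : V →L[ℝ] V) (J : Oct) {U : Set Oct} (Γ : SliceContour J U)
    (F : ℂ → ℂ) : V →L[ℝ] V :=
  (2 * Real.pi)⁻¹ • contourSum Γ fun z dz =>
    odotL (Oct.toSlice J (F z) * (-(Oct.toSlice J dz) * J))
      (rinvL ((rmo (Oct.toSlice J z) : V →L[ℝ] V) - T))

end FC

/-- The family of stems of the components, relative to `J = ∑ c_i e_i`, of a function of the
form `f₀ + f₁ • J` with `f₀, f₁` slice preserving with stems `F₀, F₁`. -/
def stemFamily (c : Fin 8 → ℝ) (F₀ F₁ : ℂ → ℂ) : Fin 8 → ℂ → ℂ :=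
  fun i z => if i = 0 then F₀ z else (c i : ℂ) * F₁ z

namespace Oct

/-- Left multiplication by an octonion, as a real-linear map. -/
def lmulLin (q : Oct) : Oct →ₗ[ℝ] Oct where
  toFun x := q * x
  map_add' x y := by
    refine Oct.ext ?_ ?_
    · show q.a * (x.a + y.a) - star (x.b + y.b) * q.b =
        (q.a * x.a - star x.b * q.b) + (q.a * y.a - star y.b * q.b)
      rw [mul_add, star_add, add_mul]; abel
    · show (x.b + y.b) * q.a + q.b * star (x.a + y.a) =
        (x.b * q.a + q.b * star x.a) + (y.b * q.a + q.b * star y.a)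
      rw [add_mul, star_add, mul_add]; abel
  map_smul' r x := by
    refine Oct.ext ?_ ?_
    · show q.a * (r • x.a) - star (r • x.b) * q.b = r • (q.a * x.a - star x.b * q.b)
      rw [mul_smul_comm, Quaternion.star_smul, smul_mul_assoc, smul_sub]
    · show (r • x.b) * q.a + q.b * star (r • x.a) = r • (x.b * q.a + q.b * star x.a)
      rw [smul_mul_assoc, Quaternion.star_smul, mul_smul_comm, smul_add]

/-- Left multiplication `L_q : x ↦ q x` as a bounded real-linear operator on `𝕆`. -/
def Lq (q : Oct) : Oct →L[ℝ] Oct := (lmulLin q).toContinuousLinearMap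

/-- The two-sphere `[q] = {Re q + |Im q| J : J ∈ 𝕊}` associated with an octonion `q`. -/
def qSphere (q : Oct) : Set Oct :=
  {s | ∃ J ∈ unitSphere, s = Oct.re q • (1 : Oct) + ‖q - Oct.re q • (1 : Oct)‖ • J}

end Oct

section HomologicalCauchy

open Filter Topology Metric Set

/-- An integral depending on a complex parameter is complex differentiable if its integrand is
locally bounded, continuous in the integration variable and holomorphic in the parameter. -/
theorem differentiableAt_intervalIntegral_of_norm_le {G : ℂ → ℝ → ℂ} {z₀ : ℂ} {r M : ℝ}
    (hr : 0 < r) (hcont : ∀ z ∈ ball z₀ r, ContinuousOn (G z) (Icc 0 1))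
    (hdiff : ∀ t ∈ Icc (0 : ℝ) 1, DifferentiableOn ℂ (fun z => G z t) (ball z₀ r))
    (hM : ∀ z ∈ ball z₀ r, ∀ t ∈ Icc (0 : ℝ) 1, ‖G z t‖ ≤ M) :
    DifferentiableAt ℂ (fun z => ∫ t in (0 : ℝ)..1, G z t) z₀ := by
  have hI : uIoc (0 : ℝ) 1 ⊆ Icc 0 1 := by
    rw [uIoc_of_le zero_le_one]; exact Ioc_subset_Icc_self
  have hii : ∀ z ∈ ball z₀ r, IntervalIntegrable (G z) MeasureTheory.volume 0 1 := fun z hz =>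
    ContinuousOn.intervalIntegrable (by rw [uIcc_of_le zero_le_one]; exact hcont z hz)
  have hmeas : ∀ z ∈ ball z₀ r, MeasureTheory.AEStronglyMeasurable (G z)
      (MeasureTheory.volume.restrict (uIoc 0 1)) := fun z hz =>
    (intervalIntegrable_iff.1 (hii z hz)).aestronglyMeasurable
  have hd : ∀ t ∈ Icc (0 : ℝ) 1, ∀ z ∈ ball z₀ r,
      HasDerivAt (fun z => G z t) (deriv (fun z => G z t) z) z := fun t ht z hz =>
    ((hdiff t ht).differentiableAt (isOpen_ball.mem_nhds hz)).hasDerivAt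
  have key := intervalIntegral.hasDerivAt_integral_of_dominated_loc_of_deriv_le
    (μ := MeasureTheory.volume) (a := 0) (b := 1) (F := G) (x₀ := z₀)
    (F' := fun z t => deriv (fun z => G z t) z) (s := ball z₀ (r / 2))
    (bound := fun _ => M / (r / 4)) (ball_mem_nhds _ (by positivity))
    (eventually_of_mem (ball_mem_nhds _ hr) hmeas) (hii z₀ (mem_ball_self hr)) ?_ ?_
    (by simp) ?_
  · exact key.2.differentiableAt
  · set u : ℕ → ℂ := fun n => z₀ + ((r / 2 / (n + 1) : ℝ) : ℂ) with hu
    have hpos : ∀ n : ℕ, 0 < r / 2 / (n + 1) := fun n => by positivity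
    have hub : ∀ n, u n ∈ ball z₀ r := fun n => by
      simp only [hu, mem_ball, dist_eq_norm, add_sub_cancel_left, Complex.norm_real,
        Real.norm_eq_abs, abs_of_pos (hpos n)]
      have : r / 2 / (n + 1) ≤ r / 2 := div_le_self (by positivity) (by simp)
      linarith
    have hulim : Tendsto u atTop (𝓝[≠] z₀) := by
      refine tendsto_nhdsWithin_iff.2 ⟨?_, Eventually.of_forall fun n => ?_⟩
      · have h1 : Tendsto (fun n : ℕ => r / 2 / ((n : ℝ) + 1)) atTop (𝓝 0) :=
          tendsto_const_nhds.div_atTop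
            (tendsto_atTop_add_const_right _ _ tendsto_natCast_atTop_atTop)
        have h2 := (Complex.continuous_ofReal.tendsto 0).comp h1
        simpa [hu] using h2.const_add z₀
      · simp only [hu, mem_compl_iff, mem_singleton_iff, add_eq_left, Complex.ofReal_eq_zero]
        exact (hpos n).ne'
    refine aestronglyMeasurable_of_tendsto_ae atTop
      (f := fun n t => slope (fun z => G z t) z₀ (u n)) (fun n => ?_) ?_
    · simp only [slope, vsub_eq_sub]
      exact ((hmeas _ (hub n)).sub (hmeas _ (mem_ball_self hr))).const_smul (u n - z₀)⁻¹
    · filter_upwards [MeasureTheory.ae_restrict_mem measurableSet_uIoc] with t ht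
      exact (hd t (hI ht) z₀ (mem_ball_self hr)).tendsto_slope.comp hulim
  · refine Eventually.of_forall fun t ht z hz => ?_
    have hsub : closedBall z (r / 4) ⊆ ball z₀ r := by
      refine closedBall_subset_ball' ?_
      rw [mem_ball] at hz
      linarith
    refine Complex.norm_deriv_le_of_forall_mem_sphere_norm_le (by positivity) ?_
      fun w hw => hM w (hsub (sphere_subset_closedBall hw)) t (hI ht)
    exact ((hdiff t (hI ht)).mono hsub).diffContOnCl_ball subset_rfl
  · exact Eventually.of_forall fun t ht z hz =>
      hd t (hI ht) z (ball_subset_ball (by linarith) hz)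

theorem exists_norm_le_of_continuousOn_Icc {g : ℝ → ℂ} (hg : ContinuousOn g (Icc 0 1)) :
    ∃ C, 0 < C ∧ ∀ t ∈ Icc (0 : ℝ) 1, ‖g t‖ ≤ C := by
  obtain ⟨C, hC⟩ := isCompact_Icc.exists_bound_of_continuousOn hg
  exact ⟨max C 1, by positivity, fun t ht => (hC t ht).trans (le_max_left _ _)⟩

/-- A Cauchy-type integral along a curve vanishes at infinity. -/
theorem tendsto_cauchyIntegral_cocompact {g γ : ℝ → ℂ} (hg : ContinuousOn g (Icc 0 1))
    (hγ : ContinuousOn γ (Icc 0 1)) :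
    Tendsto (fun z => ∫ t in (0 : ℝ)..1, g t / (γ t - z)) (cocompact ℂ) (𝓝 0) := by
  obtain ⟨M, hM0, hM⟩ := exists_norm_le_of_continuousOn_Icc hg
  obtain ⟨R, hR0, hR⟩ := exists_norm_le_of_continuousOn_Icc hγ
  rw [tendsto_zero_iff_norm_tendsto_zero, Metric.tendsto_nhds]
  intro ε hε
  filter_upwards [(tendsto_norm_cocompact_atTop (E := ℂ)).eventually_ge_atTop (R + M / (ε / 2))]
    with z hz
  have := intervalIntegral.norm_integral_le_of_norm_le_const (a := 0) (b := 1)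
    (f := fun t => g t / (γ t - z)) (C := ε / 2) fun t ht => by
      have ht' : t ∈ Icc (0 : ℝ) 1 := by
        rw [uIoc_of_le zero_le_one] at ht; exact Ioc_subset_Icc_self ht
      have h1 : M / (ε / 2) ≤ ‖γ t - z‖ := by
        have h2 := norm_sub_norm_le z (γ t)
        rw [norm_sub_rev] at h2
        linarith [hR t ht']
      have h3 : 0 < M / (ε / 2) := by positivity
      rw [norm_div, div_le_iff₀ (h3.trans_le h1)]
      rw [div_le_iff₀ (by positivity)] at h1
      linarith [hM t ht']
  simp only [sub_zero, abs_one, mul_one] at this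
  rw [dist_zero_right, norm_norm]
  linarith

/-- A Cauchy-type integral along a curve is holomorphic off the curve. -/
theorem differentiableAt_cauchyIntegral {g γ : ℝ → ℂ} {z₀ : ℂ} (hg : ContinuousOn g (Icc 0 1))
    (hγ : ContinuousOn γ (Icc 0 1)) (hz₀ : z₀ ∉ γ '' Icc 0 1) :
    DifferentiableAt ℂ (fun z => ∫ t in (0 : ℝ)..1, g t / (γ t - z)) z₀ := by
  obtain ⟨M, hM0, hM⟩ := exists_norm_le_of_continuousOn_Icc hg
  have hcl : IsClosed (γ '' Icc 0 1) := (isCompact_Icc.image_of_continuousOn hγ).isClosed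
  obtain ⟨r, hr, hball⟩ := Metric.isOpen_iff.1 hcl.isOpen_compl z₀ hz₀
  have hfar : ∀ z ∈ ball z₀ (r / 2), ∀ t ∈ Icc (0 : ℝ) 1, r / 2 ≤ ‖γ t - z‖ := by
    intro z hz t ht
    by_contra! hlt
    refine hball (a := γ t) ?_ (mem_image_of_mem γ ht)
    rw [mem_ball] at hz ⊢
    rw [← dist_eq_norm] at hlt
    linarith [dist_triangle (γ t) z z₀]
  have hne : ∀ z ∈ ball z₀ (r / 2), ∀ t ∈ Icc (0 : ℝ) 1, γ t - z ≠ 0 := fun z hz t ht =>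
    norm_pos_iff.1 ((half_pos hr).trans_le (hfar z hz t ht))
  refine differentiableAt_intervalIntegral_of_norm_le (half_pos hr) (M := M / (r / 2))
    (fun z hz => hg.div (hγ.sub continuousOn_const) (hne z hz))
    (fun t ht => (differentiableOn_const _).div
      ((differentiableOn_const _).sub differentiableOn_id) fun z hz => hne z hz t ht)
    fun z hz t ht => ?_
  rw [norm_div]
  exact div_le_div₀ hM0.le (hM t ht) (half_pos hr) (hfar z hz t ht)

theorem dslope_comm (F : ℂ → ℂ) (z w : ℂ) : dslope F z w = dslope F w z := by
  rcases eq_or_ne z w with rfl | h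
  · rfl
  · rw [dslope_of_ne F h.symm, dslope_of_ne F h, slope_comm]

/-- The difference quotient of a holomorphic function is bounded as one variable stays in a
compact curve and the other one in a small ball. -/
theorem exists_norm_dslope_le {D : Set ℂ} (hD : IsOpen D) {F : ℂ → ℂ}
    (hF : DifferentiableOn ℂ F D) {γ : ℝ → ℂ} (hγ : ContinuousOn γ (Icc 0 1))
    (hγD : ∀ t ∈ Icc (0 : ℝ) 1, γ t ∈ D) {z₀ : ℂ} (hz₀ : z₀ ∈ D) :
    ∃ r > 0, ball z₀ r ⊆ D ∧ ∃ M, 0 < M ∧ ∀ z ∈ ball z₀ r, ∀ t ∈ Icc (0 : ℝ) 1,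
      ‖dslope F z (γ t)‖ ≤ M := by
  obtain ⟨N, hN0, hN⟩ := exists_norm_le_of_continuousOn_Icc (hF.continuousOn.comp hγ hγD)
  have hC1 : ContDiffAt ℂ 1 F z₀ := (hF.contDiffOn hD).contDiffAt (hD.mem_nhds hz₀)
  obtain ⟨K, s, hs, hK⟩ := hC1.exists_lipschitzOnWith
  have hs' : s ∩ D ∈ 𝓝 z₀ := inter_mem hs (hD.mem_nhds hz₀)
  obtain ⟨ρ, hρ, hball⟩ := Metric.mem_nhds_iff.1 hs'
  have hsub : ball z₀ (ρ / 2) ⊆ ball z₀ ρ := ball_subset_ball (by linarith)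
  refine ⟨ρ / 2, half_pos hρ, fun z hz => (hball (hsub hz)).2,
    max (K : ℝ) ((N + (‖F z₀‖ + K * (ρ / 2))) / (ρ / 2)), lt_max_of_lt_right (by positivity),
    fun z hz t ht => ?_⟩
  have hzs := (hball (hsub hz)).1
  by_cases hw : γ t ∈ ball z₀ ρ
  · refine le_max_of_le_left ?_
    rcases eq_or_ne (γ t) z with h | h
    · rw [h, dslope_same]
      exact norm_deriv_le_of_lipschitzOn (mem_of_superset (isOpen_ball.mem_nhds (hsub hz))
        fun x hx => (hball hx).1) hK
    · rw [dslope_of_ne F h, slope_def_field, norm_div,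
        div_le_iff₀ (norm_pos_iff.2 (sub_ne_zero.2 h))]
      exact hK.norm_sub_le (hball hw).1 hzs
  · refine le_max_of_le_right ?_
    have hfar : ρ / 2 ≤ ‖γ t - z‖ := by
      rw [mem_ball, not_lt] at hw
      rw [mem_ball] at hz
      rw [← dist_eq_norm]
      linarith [dist_triangle (γ t) z z₀]
    have hne : γ t ≠ z := sub_ne_zero.1 (norm_pos_iff.1 ((half_pos hρ).trans_le hfar))
    rw [dslope_of_ne F hne, slope_def_field, norm_div]
    refine div_le_div₀ (by positivity) ((norm_sub_le _ _).trans
      (add_le_add (hN t ht) ?_)) (half_pos hρ) hfar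
    have h1 := hK.norm_sub_le hzs (hball (mem_ball_self hρ)).1
    have h2 : ‖z - z₀‖ ≤ ρ / 2 := by
      rw [← dist_eq_norm]; exact (mem_ball.1 hz).le
    have h3 : (K : ℝ) * ‖z - z₀‖ ≤ K * (ρ / 2) := by gcongr
    linarith [norm_sub_norm_le (F z) (F z₀)]

theorem differentiableAt_integral_dslope {D : Set ℂ} (hD : IsOpen D) {F : ℂ → ℂ}
    (hF : DifferentiableOn ℂ F D) {γ g : ℝ → ℂ} (hγ : ContinuousOn γ (Icc 0 1))
    (hg : ContinuousOn g (Icc 0 1))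
    (hγD : ∀ t ∈ Icc (0 : ℝ) 1, γ t ∈ D) {z₀ : ℂ} (hz₀ : z₀ ∈ D) :
    DifferentiableAt ℂ (fun z => ∫ t in (0 : ℝ)..1, dslope F z (γ t) * g t) z₀ := by
  obtain ⟨r, hr, hrD, M, hM0, hM⟩ := exists_norm_dslope_le hD hF hγ hγD hz₀
  obtain ⟨N, hN0, hN⟩ := exists_norm_le_of_continuousOn_Icc hg
  have hds : ∀ w ∈ D, DifferentiableOn ℂ (dslope F w) D := fun w hw =>
    (Complex.differentiableOn_dslope (hD.mem_nhds hw)).2 hF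
  refine differentiableAt_intervalIntegral_of_norm_le hr (M := M * N)
    (fun z hz => ((hds z (hrD hz)).continuousOn.comp hγ hγD).mul hg)
    (fun t ht => ?_) fun z hz t ht => ?_
  · simp only [dslope_comm F _ (γ t)]
    exact ((hds _ (hγD t ht)).mono hrD).mul_const _
  · rw [norm_mul]
    exact mul_le_mul (hM z hz t ht) (hN t ht) (norm_nonneg _) hM0.le

/-- Homological form of Cauchy's integral formula: it holds for every cycle in the open set `D`
whose winding number vanishes on an open set `E ⊇ Dᶜ` off the cycle. -/
theorem cauchy_integral_formula_cycle {n : ℕ} {γ : Fin n → ℝ → ℂ}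
    (hγ : ∀ i, ContDiff ℝ 1 (γ i)) {D E : Set ℂ} (hD : IsOpen D) (hE : IsOpen E)
    (hDE : D ∪ E = univ) {F : ℂ → ℂ} (hF : DifferentiableOn ℂ F D)
    (hγD : ∀ i, ∀ t ∈ Icc (0 : ℝ) 1, γ i t ∈ D) (hγE : ∀ i, ∀ t ∈ Icc (0 : ℝ) 1, γ i t ∉ E)
    (hE0 : ∀ z ∈ E, ∑ i, ∫ t in (0 : ℝ)..1, deriv (γ i) t / (γ i t - z) = 0)
    (hEinf : ∀ᶠ z in cocompact ℂ, z ∈ E) {z₀ : ℂ} (hz₀ : z₀ ∈ D)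
    (hz₀γ : ∀ i, ∀ t ∈ Icc (0 : ℝ) 1, γ i t ≠ z₀) :
    ∑ i, ∫ t in (0 : ℝ)..1, F (γ i t) * deriv (γ i) t / (γ i t - z₀) =
      F z₀ * ∑ i, ∫ t in (0 : ℝ)..1, deriv (γ i) t / (γ i t - z₀) := by
  classical
  have hγc : ∀ i, ContinuousOn (γ i) (Icc 0 1) := fun i => (hγ i).continuous.continuousOn
  have hdc : ∀ i, ContinuousOn (deriv (γ i)) (Icc 0 1) := fun i =>
    ((hγ i).continuous_deriv le_rfl).continuousOn
  have hFc : ∀ i, ContinuousOn (fun t => F (γ i t) * deriv (γ i) t) (Icc 0 1) := fun i =>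
    (hF.continuousOn.comp (hγc i) (hγD i)).mul (hdc i)
  have hrel : ∀ z, (∀ i, ∀ t ∈ Icc (0 : ℝ) 1, γ i t ≠ z) →
      ∑ i, ∫ t in (0 : ℝ)..1, dslope F z (γ i t) * deriv (γ i) t =
        ∑ i, (∫ t in (0 : ℝ)..1, F (γ i t) * deriv (γ i) t / (γ i t - z)) -
          F z * ∑ i, ∫ t in (0 : ℝ)..1, deriv (γ i) t / (γ i t - z) := by
    intro z hz
    rw [Finset.mul_sum, ← Finset.sum_sub_distrib]
    refine Finset.sum_congr rfl fun i _ => ?_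
    have hsub : ∀ t ∈ Icc (0 : ℝ) 1, γ i t - z ≠ 0 := fun t ht => sub_ne_zero.2 (hz i t ht)
    have hii : ∀ g : ℝ → ℂ, ContinuousOn g (Icc 0 1) →
        IntervalIntegrable (fun t => g t / (γ i t - z)) MeasureTheory.volume 0 1 := fun g hg =>
      ContinuousOn.intervalIntegrable (by
        rw [uIcc_of_le zero_le_one]
        exact hg.div ((hγc i).sub continuousOn_const) hsub)
    rw [← intervalIntegral.integral_const_mul,
      ← intervalIntegral.integral_sub (hii _ (hFc i)) ((hii _ (hdc i)).const_mul _)]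
    refine intervalIntegral.integral_congr fun t ht => ?_
    rw [uIcc_of_le zero_le_one] at ht
    simp only [dslope_of_ne F (hz i t ht), slope_def_field]
    ring
  set H : ℂ → ℂ := fun z =>
    if z ∈ D then ∑ i, ∫ t in (0 : ℝ)..1, dslope F z (γ i t) * deriv (γ i) t
    else ∑ i, ∫ t in (0 : ℝ)..1, F (γ i t) * deriv (γ i) t / (γ i t - z) with hH
  have hHE : ∀ z ∈ E, H z =
      ∑ i, ∫ t in (0 : ℝ)..1, F (γ i t) * deriv (γ i) t / (γ i t - z) := by
    intro z hz
    by_cases hzD : z ∈ D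
    · simp only [hH, if_pos hzD]
      rw [hrel z fun i t ht h => hγE i t ht (h ▸ hz), hE0 z hz, mul_zero, sub_zero]
    · simp only [hH, if_neg hzD]
  have hdiff : Differentiable ℂ H := by
    intro z
    rcases (hDE ▸ mem_univ z : z ∈ D ∪ E) with hz | hz
    · refine (DifferentiableAt.fun_sum fun i _ =>
        differentiableAt_integral_dslope hD hF (hγc i) (hdc i) (hγD i) hz).congr_of_eventuallyEq
        (eventually_of_mem (hD.mem_nhds hz) fun w hw => if_pos hw)
    · refine (DifferentiableAt.fun_sum fun i _ =>
        differentiableAt_cauchyIntegral (hFc i) (hγc i) ?_).congr_of_eventuallyEq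
        (eventually_of_mem (hE.mem_nhds hz) hHE)
      rintro ⟨t, ht, rfl⟩
      exact hγE i t ht hz
  have hlim : Tendsto H (cocompact ℂ) (𝓝 0) := by
    have h1 := tendsto_finsetSum Finset.univ fun i _ =>
      tendsto_cauchyIntegral_cocompact (hFc i) (hγc i)
    rw [Finset.sum_const_zero] at h1
    exact h1.congr' (hEinf.mono fun z hz => (hHE z hz).symm)
  have h0 := hdiff.apply_eq_of_tendsto_cocompact z₀ hlim
  simp only [hH, if_pos hz₀, hrel z₀ hz₀γ] at h0
  exact sub_eq_zero.1 h0

end HomologicalCauchy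

namespace Oct

@[simp] theorem add_a (x y : Oct) : (x + y).a = x.a + y.a := rfl
@[simp] theorem add_b (x y : Oct) : (x + y).b = x.b + y.b := rfl
@[simp] theorem sub_a (x y : Oct) : (x - y).a = x.a - y.a := rfl
@[simp] theorem sub_b (x y : Oct) : (x - y).b = x.b - y.b := rfl
@[simp] theorem neg_a (x : Oct) : (-x).a = -x.a := rfl
@[simp] theorem neg_b (x : Oct) : (-x).b = -x.b := rfl
@[simp] theorem smul_a (r : ℝ) (x : Oct) : (r • x).a = r • x.a := rfl
@[simp] theorem smul_b (r : ℝ) (x : Oct) : (r • x).b = r • x.b := rfl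
@[simp] theorem zero_a : (0 : Oct).a = 0 := rfl
@[simp] theorem zero_b : (0 : Oct).b = 0 := rfl
@[simp] theorem one_a : (1 : Oct).a = 1 := rfl
@[simp] theorem one_b : (1 : Oct).b = 0 := rfl
@[simp] theorem mul_a (x y : Oct) : (x * y).a = x.a * y.a - star y.b * x.b := rfl
@[simp] theorem mul_b (x y : Oct) : (x * y).b = y.b * x.a + x.b * star y.a := rfl

protected theorem mul_add (x y z : Oct) : x * (y + z) = x * y + x * z :=
  (lmulLin x).map_add y z

protected theorem mul_smul (r : ℝ) (x y : Oct) : x * (r • y) = r • (x * y) :=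
  (lmulLin x).map_smul r y

protected theorem mul_neg (x y : Oct) : x * (-y) = -(x * y) :=
  (lmulLin x).map_neg y

protected theorem mul_sub (x y z : Oct) : x * (y - z) = x * y - x * z :=
  (lmulLin x).map_sub y z

protected theorem add_mul (x y z : Oct) : (x + y) * z = x * z + y * z := by
  ext1
  · simp only [mul_a, add_a, add_b, _root_.add_mul, _root_.mul_add]; abel
  · simp only [mul_b, add_a, add_b, _root_.add_mul, _root_.mul_add]; abel

protected theorem smul_mul (r : ℝ) (x y : Oct) : (r • x) * y = r • (x * y) := by
  ext1 <;> simp [smul_sub]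

protected theorem neg_mul (x y : Oct) : (-x) * y = -(x * y) := by
  rw [← neg_one_smul ℝ x, Oct.smul_mul, neg_one_smul]

protected theorem sub_mul (x y z : Oct) : (x - y) * z = x * z - y * z := by
  rw [sub_eq_add_neg, Oct.add_mul, Oct.neg_mul, ← sub_eq_add_neg]

protected theorem one_mul (x : Oct) : 1 * x = x := by ext1 <;> simp

protected theorem mul_one (x : Oct) : x * 1 = x := by ext1 <;> simp

theorem one_ne_zero' : (1 : Oct) ≠ 0 := fun h => one_ne_zero (congrArg Oct.a h)

/-- Left alternativity. -/
theorem mul_self_mul (x y : Oct) : x * x * y = x * (x * y) := by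
  ext <;> simp <;> ring

/-- Right alternativity. -/
theorem mul_mul_self (x y : Oct) : x * y * y = x * (y * y) := by
  ext <;> simp <;> ring

/-- The associator is alternating in its last two arguments. -/
theorem mul_mul_sub_associator (w p x : Oct) :
    w * (p * x) - (w * x * p - w * (x * p)) = w * p * x := by
  have h := mul_mul_self w (p + x)
  simp only [Oct.mul_add, Oct.add_mul, mul_mul_self] at h
  have h' : w * x * p + w * p * x = w * (x * p) + w * (p * x) := by
    have := congrArg (fun t => t - w * (p * p) - w * (x * x)) h
    convert this using 1 <;> abel
  rw [eq_comm, ← sub_eq_zero]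
  rw [← sub_eq_zero] at h'
  convert h' using 1
  abel

theorem norm_sq (x : Oct) : ‖x‖ ^ 2 = ‖x.a‖ ^ 2 + ‖x.b‖ ^ 2 :=
  WithLp.prod_norm_sq_eq_of_L2 (toLp x)

open scoped Quaternion in
theorem re_eq_zero_of_mem_unitSphere {J : Oct} (hJ : J ∈ unitSphere) : J.a.re = 0 := by
  have hJ : J * J = -1 := hJ
  by_contra h
  have ha := congrArg Oct.a hJ
  have hb := congrArg Oct.b hJ
  have h0 := congrArg QuaternionAlgebra.re ha
  have h1 := congrArg QuaternionAlgebra.imI ha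
  have h2 := congrArg QuaternionAlgebra.imJ ha
  have h3 := congrArg QuaternionAlgebra.imK ha
  have k0 := congrArg QuaternionAlgebra.re hb
  have k1 := congrArg QuaternionAlgebra.imI hb
  have k2 := congrArg QuaternionAlgebra.imJ hb
  have k3 := congrArg QuaternionAlgebra.imK hb
  simp at h0 h1 h2 h3 k0 k1 k2 k3
  have e1 : J.a.imI = 0 := mul_left_cancel₀ h (by linarith)
  have e2 : J.a.imJ = 0 := mul_left_cancel₀ h (by linarith)
  have e3 : J.a.imK = 0 := mul_left_cancel₀ h (by linarith)
  have f0 : J.b.re = 0 := k0.resolve_right h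
  have f1 : J.b.imI = 0 := mul_left_cancel₀ h (by linarith)
  have f2 : J.b.imJ = 0 := mul_left_cancel₀ h (by linarith)
  have f3 : J.b.imK = 0 := mul_left_cancel₀ h (by linarith)
  rw [e1, e2, e3, f0, f1, f2, f3] at h0
  nlinarith [mul_self_nonneg J.a.re]

open scoped Quaternion in
theorem norm_toSlice {J : Oct} (hJ : J ∈ unitSphere) (z : ℂ) : ‖toSlice J z‖ = ‖z‖ := by
  have hre := re_eq_zero_of_mem_unitSphere hJ
  have hJ : J * J = -1 := hJ
  have h0 := congrArg (fun x : Oct => x.a.re) hJ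
  simp at h0
  rw [← sq_eq_sq₀ (norm_nonneg _) (norm_nonneg _), norm_sq, Complex.sq_norm, Complex.normSq_apply,
    sq ‖(toSlice J z).a‖, sq ‖(toSlice J z).b‖, ← Quaternion.normSq_eq_norm_mul_self,
    ← Quaternion.normSq_eq_norm_mul_self, Quaternion.normSq_def', Quaternion.normSq_def']
  rw [hre] at h0
  simp [toSlice, hre]
  linear_combination (-z.im * z.im) * h0

open scoped Quaternion in
theorem re_toSlice {J : Oct} (hJ : J ∈ unitSphere) (z : ℂ) : (toSlice J z).a.re = z.re := by
  simp [toSlice, re_eq_zero_of_mem_unitSphere hJ]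

theorem neg_mem_unitSphere {J : Oct} (hJ : J ∈ unitSphere) : -J ∈ unitSphere := by
  have hJ : J * J = -1 := hJ
  change -J * -J = -1
  rw [Oct.neg_mul, Oct.mul_neg, neg_neg, hJ]

theorem toSlice_neg (J : Oct) (z : ℂ) : toSlice (-J) (starRingEnd ℂ z) = toSlice J z := by
  simp [toSlice]

theorem continuous_toSlice (J : Oct) : Continuous (toSlice J) := by
  unfold toSlice
  fun_prop

theorem toSlice_one (J : Oct) : toSlice J 1 = 1 := by simp [toSlice]

theorem mul_toSlice_mul_toSlice {J : Oct} (hJ : J ∈ unitSphere) (u v : ℂ) (x : Oct) :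
    x * toSlice J u * toSlice J v = x * toSlice J (u * v) := by
  have hJ : J * J = -1 := hJ
  have h : x * J * J = -x := by rw [mul_mul_self, hJ, Oct.mul_neg, Oct.mul_one]
  simp only [toSlice, Oct.add_mul, Oct.smul_mul, Oct.mul_one, Oct.mul_add, Oct.mul_smul, h,
    Complex.mul_re, Complex.mul_im]
  module

theorem toSlice_mul {J : Oct} (hJ : J ∈ unitSphere) (u v : ℂ) :
    toSlice J u * toSlice J v = toSlice J (u * v) := by
  simpa only [Oct.one_mul] using mul_toSlice_mul_toSlice hJ u v 1

theorem toSlice_I (J : Oct) : toSlice J Complex.I = J := by simp [toSlice]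

/-- `toSlice` as a real-linear map. -/
def toSliceLin (J : Oct) : ℂ →ₗ[ℝ] Oct where
  toFun := toSlice J
  map_add' u v := by simp only [toSlice, Complex.add_re, Complex.add_im]; module
  map_smul' r u := by simp [toSlice, smul_smul]

/-- The component of `toSlice J v` on which left multiplication by `I` acts as right
multiplication by `J`. -/
def slicePart (I J : Oct) : ℂ →ₗ[ℝ] Oct :=
  (1 / 2 : ℝ) • (toSliceLin J -
    (lmulLin I).comp ((toSliceLin J).comp (LinearMap.mulLeft ℝ Complex.I)))

theorem slicePart_apply (I J : Oct) (v : ℂ) :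
    slicePart I J v = (1 / 2 : ℝ) • (toSlice J v - I * toSlice J (Complex.I * v)) := rfl

theorem slicePart_mul_toSlice (I : Oct) {J : Oct} (hJ : J ∈ unitSphere) (v u : ℂ) :
    slicePart I J v * toSlice J u = slicePart I J (v * u) := by
  simp only [slicePart_apply, Oct.smul_mul, Oct.sub_mul, mul_toSlice_mul_toSlice hJ,
    toSlice_mul hJ, mul_assoc]

theorem toSlice_mul_slicePart {I : Oct} (hI : I ∈ unitSphere) (J : Oct) (u v : ℂ) :
    toSlice I u * slicePart I J v = slicePart I J (u * v) := by
  have hI' : I * I = -1 := hI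
  have h : ∀ x, I * (I * x) = -x := fun x => by
    rw [← mul_self_mul, hI', Oct.neg_mul, Oct.one_mul]
  have key : slicePart I J (Complex.I * v) = I * slicePart I J v := by
    have hn : toSlice J (-v) = -toSlice J v := (toSliceLin J).map_neg v
    simp only [slicePart_apply, Oct.mul_smul, Oct.mul_sub, h, ← mul_assoc, Complex.I_mul_I,
      neg_one_mul, hn, Oct.mul_neg]
    module
  have huv : u * v = u.re • v + u.im • (Complex.I * v) := by
    simp only [Complex.real_smul, ← mul_assoc, ← add_mul, Complex.re_add_im]
  rw [huv, map_add, map_smul, map_smul, key, toSlice, Oct.add_mul, Oct.smul_mul, Oct.smul_mul,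
    Oct.one_mul]

theorem slicePart_add_slicePart_neg (I J : Oct) (v : ℂ) :
    slicePart I J v + slicePart (-I) J v = toSlice J v := by
  simp only [slicePart_apply, Oct.neg_mul]
  module

theorem slicePart_add_slicePart_neg_conj {I : Oct} (hI : I ∈ unitSphere) (J : Oct) (v : ℂ) :
    slicePart I J v + slicePart (-I) J (starRingEnd ℂ v) = toSlice I v := by
  have h1 := toSlice_mul_slicePart hI J v 1
  have h2 := toSlice_mul_slicePart (neg_mem_unitSphere hI) J (starRingEnd ℂ v) 1
  rw [mul_one] at h1 h2
  rw [← h1, ← h2, toSlice_neg, ← Oct.mul_add, slicePart_add_slicePart_neg, toSlice_one, Oct.mul_one]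

end Oct

theorem exists_eNat_eq : ∃ i j k : Quaternion ℝ,
    (eNat 1 = ⟨i, 0⟩ ∧ eNat 2 = ⟨j, 0⟩ ∧ eNat 3 = ⟨k, 0⟩ ∧
      eNat 5 = ⟨0, i⟩ ∧ eNat 6 = ⟨0, j⟩ ∧ eNat 7 = ⟨0, k⟩) ∧
    (i.re = 0 ∧ i.imI = 1 ∧ i.imJ = 0 ∧ i.imK = 0) ∧
    (j.re = 0 ∧ j.imI = 0 ∧ j.imJ = 1 ∧ j.imK = 0) ∧
    (k.re = 0 ∧ k.imI = 0 ∧ k.imJ = 0 ∧ k.imK = 1) :=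
  ⟨⟨0, 1, 0, 0⟩, ⟨0, 0, 1, 0⟩, ⟨0, 0, 0, 1⟩, ⟨rfl, rfl, rfl, rfl, rfl, rfl⟩,
    ⟨rfl, rfl, rfl, rfl⟩, ⟨rfl, rfl, rfl, rfl⟩, ⟨rfl, rfl, rfl, rfl⟩⟩

open scoped Quaternion in
theorem sum_re_mul_conj_smul (x : Oct) :
    ∑ i : Fin 8, (x * Oct.conj (e i)).a.re • e i = x := by
  have h0 : eNat 0 = ⟨1, 0⟩ := rfl
  have h4 : eNat 4 = ⟨0, 1⟩ := rfl
  obtain ⟨i, j, k, ⟨h1, h2, h3, h5, h6, h7⟩, ⟨hi0, hi1, hi2, hi3⟩, ⟨hj0, hj1, hj2, hj3⟩,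
    hk0, hk1, hk2, hk3⟩ := exists_eNat_eq
  simp only [Fin.sum_univ_eight, e]
  ext <;> simp [h0, h1, h2, h3, h4, h5, h6, h7, hi0, hi1, hi2, hi3, hj0, hj1, hj2, hj3,
    hk0, hk1, hk2, hk3, Oct.conj]

theorem Complex.eq_or_eq_conj {z w : ℂ} (hre : z.re = w.re) (hn : ‖z‖ = ‖w‖) :
    z = w ∨ z = starRingEnd ℂ w := by
  have h : z.im * z.im = w.im * w.im := by
    have h := congrArg (· ^ 2) hn
    simp only [Complex.sq_norm, Complex.normSq_apply, hre] at h
    linarith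
  rcases mul_self_eq_mul_self_iff.1 h with h | h
  · exact Or.inl (Complex.ext hre h)
  · exact Or.inr (Complex.ext (by simpa using hre) (by simpa using h))

theorem toSlice_eq_toSlice {I J : Oct} (hI : I ∈ unitSphere) (hJ : J ∈ unitSphere) {z w : ℂ}
    (h : toSlice J z = toSlice I w) : z = w ∨ z = starRingEnd ℂ w := by
  refine Complex.eq_or_eq_conj ?_ ?_
  · rw [← re_toSlice hJ, h, re_toSlice hI]
  · rw [← norm_toSlice hJ, h, norm_toSlice hI]

theorem Lq_add (p q : Oct) : Oct.Lq (p + q) = Oct.Lq p + Oct.Lq q :=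
  ContinuousLinearMap.ext fun x => Oct.add_mul p q x

section LeftMultiplication

variable [OctBimodule Oct]

theorem lmo_eq_Lq (hlm : ∀ p x : Oct, lmo p x = p * x) (p : Oct) :
    (lmo p : Oct →L[ℝ] Oct) = Oct.Lq p :=
  ContinuousLinearMap.ext fun x => hlm p x

theorem Oct.norm_mul (hlm : ∀ p x : Oct, lmo p x = p * x) (p x : Oct) :
    ‖p * x‖ = ‖p‖ * ‖x‖ :=
  hlm p x ▸ OctBimodule.norm_lm p x

open scoped Quaternion in
theorem reO_eq (hlm : ∀ p x : Oct, lmo p x = p * x) (hrm : ∀ p x : Oct, rmo p x = x * p)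
    (x : Oct) : reO Oct x = x.a.re • (1 : Oct) := by
  have h : reO Oct x = (5 / 12 : ℝ) • x -
      (1 / 12 : ℝ) • ∑ i : Fin 7, (e i.succ * x) * e i.succ := by
    simp [reO, hlm, hrm]
  have h4 : eNat 4 = ⟨0, 1⟩ := rfl
  obtain ⟨i, j, k, ⟨h1, h2, h3, h5, h6, h7⟩, ⟨hi0, hi1, hi2, hi3⟩, ⟨hj0, hj1, hj2, hj3⟩,
    hk0, hk1, hk2, hk3⟩ := exists_eNat_eq
  rw [h]
  simp only [Fin.sum_univ_seven, e, Fin.val_succ]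
  ext <;> simp [h1, h2, h3, h4, h5, h6, h7, hi0, hi1, hi2, hi3, hj0, hj1, hj2, hj3,
    hk0, hk1, hk2, hk3] <;> ring

theorem extO_eq (hlm : ∀ p x : Oct, lmo p x = p * x) (hrm : ∀ p x : Oct, rmo p x = x * p)
    (G : Oct →L[ℝ] Oct) : extO G = Oct.Lq (G 1) := by
  ext1 x
  have h : extO G x = ∑ i : Fin 8, G ((x * Oct.conj (e i)).a.re • (1 : Oct)) * e i := by
    simp [extO, hrm, reO_eq hlm hrm]
  rw [h]
  conv_rhs => rw [← sum_re_mul_conj_smul x, map_sum]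
  refine Finset.sum_congr rfl fun i _ => ?_
  rw [map_smul, Oct.smul_mul, map_smul]
  rfl

theorem odotR_Lq (hlm : ∀ p x : Oct, lmo p x = p * x) (hrm : ∀ p x : Oct, rmo p x = x * p)
    (w p : Oct) : odotR (Oct.Lq w) p = Oct.Lq (w * p) := by
  ext1 x
  simp only [odotR, Bop, sub_apply, ContinuousLinearMap.comp_apply, hlm, hrm]
  exact mul_mul_sub_associator w p x

theorem mem_pbSpec_Lq (hrm : ∀ p x : Oct, rmo p x = x * p) (q : Oct) :
    q ∈ pbSpec (Oct.Lq q) := by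
  refine ⟨Set.mem_univ _, fun h => ?_⟩
  simp only [pbRes, Set.mem_iUnion] at h
  obtain ⟨J, -, -, ⟨u, hu⟩, -⟩ := h
  have h1 : (u : Oct →L[ℝ] Oct) 1 = 0 := by
    rw [hu, sub_apply, hrm]
    change 1 * q - q * 1 = 0
    rw [Oct.one_mul, Oct.mul_one, sub_self]
  have h2 : ((↑u⁻¹ * ↑u : Oct →L[ℝ] Oct)) 1 = 0 := by
    rw [mul_apply_eq_comp, h1, map_zero]
  rw [Units.inv_mul] at h2
  exact one_ne_zero' h2

/-- The operator `R_s - L_q` is invertible unless `s` lies in the sphere of `q`. -/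
theorem isUnit_rmo_sub_Lq (hlm : ∀ p x : Oct, lmo p x = p * x)
    (hrm : ∀ p x : Oct, rmo p x = x * p) {I J : Oct} (hI : I ∈ unitSphere)
    (hJ : J ∈ unitSphere) {z w : ℂ} (h1 : z ≠ w) (h2 : z ≠ starRingEnd ℂ w) :
    IsUnit ((rmo (toSlice J z) : Oct →L[ℝ] Oct) - Oct.Lq (toSlice I w)) := by
  set T := (rmo (toSlice J z) : Oct →L[ℝ] Oct) - Oct.Lq (toSlice I w) with hT
  have hinj : Function.Injective T := by
    refine (injective_iff_map_eq_zero T).2 fun x hx => ?_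
    by_contra hx0
    have hx : x * toSlice J z = toSlice I w * x := by
      rw [hT, sub_apply, hrm] at hx
      exact sub_eq_zero.1 hx
    have hnorm : ∀ c : ℝ, ‖z - c‖ = ‖w - c‖ := by
      intro c
      have hs : ∀ K : Oct, ∀ v : ℂ, toSlice K (v - c) = toSlice K v - c • 1 := fun K v => by
        simp only [toSlice, Complex.sub_re, Complex.sub_im, Complex.ofReal_re,
          Complex.ofReal_im]
        module
      have hc : x * toSlice J (z - c) = toSlice I (w - c) * x := by
        rw [hs, hs, Oct.mul_sub, Oct.sub_mul, hx, Oct.mul_smul, Oct.smul_mul, Oct.mul_one,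
          Oct.one_mul]
      have hn := congrArg norm hc
      rw [Oct.norm_mul hlm, Oct.norm_mul hlm, norm_toSlice hI, norm_toSlice hJ, mul_comm] at hn
      exact mul_right_cancel₀ (norm_ne_zero_iff.2 hx0) hn
    have hn0 := hnorm 0
    have hre : z.re = w.re := by
      have e0 := congrArg (· ^ 2) hn0
      have e1 := congrArg (· ^ 2) (hnorm 1)
      simp [Complex.sq_norm, Complex.normSq_apply] at e0 e1
      linarith
    rcases Complex.eq_or_eq_conj hre (by simpa using hn0) with h | h
    exacts [h1 h, h2 h]
  refine ContinuousLinearMap.isUnit_iff_bijective.2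
    ⟨hinj, (LinearMap.injective_iff_surjective (f := T.toLinearMap)).1 hinj⟩

/-- The regular inverse of `R_s - L_q`, computed through the splitting of the slice kernel. -/
theorem rinvR_rmo_sub_Lq (hlm : ∀ p x : Oct, lmo p x = p * x)
    (hrm : ∀ p x : Oct, rmo p x = x * p) {I J : Oct} (hI : I ∈ unitSphere)
    (hJ : J ∈ unitSphere) {z w : ℂ} (h1 : z ≠ w) (h2 : z ≠ starRingEnd ℂ w) :
    rinvR ((rmo (toSlice J z) : Oct →L[ℝ] Oct) - Oct.Lq (toSlice I w)) =
      Oct.Lq (slicePart I J (z - w)⁻¹ + slicePart (-I) J (z - starRingEnd ℂ w)⁻¹) := by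
  rw [rinvR, extO_eq hlm hrm]
  congr 1
  have hunit := isUnit_rmo_sub_Lq hlm hrm hI hJ h1 h2
  set k := slicePart I J (z - w)⁻¹ + slicePart (-I) J (z - starRingEnd ℂ w)⁻¹ with hk
  set T := (rmo (toSlice J z) : Oct →L[ℝ] Oct) - Oct.Lq (toSlice I w) with hT
  have hTk : T k = 1 := by
    have hq1 : toSlice I w * slicePart I J (z - w)⁻¹ = slicePart I J (w * (z - w)⁻¹) :=
      toSlice_mul_slicePart hI _ _ _
    have hq2 : toSlice I w * slicePart (-I) J (z - starRingEnd ℂ w)⁻¹ =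
        slicePart (-I) J (starRingEnd ℂ w * (z - starRingEnd ℂ w)⁻¹) := by
      rw [← toSlice_neg, toSlice_mul_slicePart (neg_mem_unitSphere hI)]
    have ha : (z - w)⁻¹ * z - w * (z - w)⁻¹ = 1 := by
      rw [mul_comm w, ← mul_sub, inv_mul_cancel₀ (sub_ne_zero.2 h1)]
    have hb : (z - starRingEnd ℂ w)⁻¹ * z - starRingEnd ℂ w * (z - starRingEnd ℂ w)⁻¹ = 1 := by
      rw [mul_comm (starRingEnd ℂ w), ← mul_sub, inv_mul_cancel₀ (sub_ne_zero.2 h2)]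
    rw [hT, sub_apply, hrm]
    change k * toSlice J z - toSlice I w * k = 1
    rw [hk, Oct.add_mul, Oct.mul_add, slicePart_mul_toSlice I hJ, slicePart_mul_toSlice (-I) hJ,
      hq1, hq2, add_sub_add_comm, ← map_sub, ← map_sub, ha, hb, slicePart_add_slicePart_neg,
      toSlice_one]
  rw [← hTk, ← mul_apply_eq_comp, Ring.inverse_mul_cancel _ hunit]
  rfl

/-- The component map `v ↦ L_{slicePart I J v}` as a bounded real-linear map. -/
def slicePartOp (I J : Oct) : ℂ →L[ℝ] Oct →L[ℝ] Oct :=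
  (OctBimodule.lm.comp (slicePart I J)).toContinuousLinearMap

theorem slicePartOp_apply (hlm : ∀ p x : Oct, lmo p x = p * x) (I J : Oct) (v : ℂ) :
    slicePartOp I J v = Oct.Lq (slicePart I J v) :=
  lmo_eq_Lq hlm _

end LeftMultiplication

section Contour

open Set Filter Topology

variable {J : Oct} {U : Set Oct}

theorem mem_frontier_of_contour (Γ : SliceContour J U) (i : Fin Γ.n) {t : ℝ}
    (ht : t ∈ Icc (0 : ℝ) 1) : Γ.γ i t ∈ frontier (toSlice J ⁻¹' U) :=
  Γ.image_eq ▸ mem_iUnion.2 ⟨i, mem_image_of_mem _ ht⟩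

theorem toSlice_mem_closure_of_contour (Γ : SliceContour J U) (i : Fin Γ.n) {t : ℝ}
    (ht : t ∈ Icc (0 : ℝ) 1) : toSlice J (Γ.γ i t) ∈ closure U :=
  (continuous_toSlice J).closure_preimage_subset U
    (frontier_subset_closure (mem_frontier_of_contour Γ i ht))

/-- An axially symmetric open set whose slice boundary is a contour is bounded in the slice. -/
theorem eventually_toSlice_notMem_closure (hJ : J ∈ unitSphere) (Γ : SliceContour J U)
    (hax : ∀ z : ℂ, ∀ I ∈ unitSphere, toSlice I z ∈ U → toSlice J z ∈ U)
    (hslice : ∀ s ∈ U, ∃ I ∈ unitSphere, ∃ z, s = toSlice I z) :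
    ∀ᶠ z in cocompact ℂ, toSlice J z ∉ closure U := by
  have hlim : Tendsto (fun z => ∑ i, ∫ t in (0 : ℝ)..1, deriv (Γ.γ i) t / (Γ.γ i t - z))
      (cocompact ℂ) (𝓝 0) := by
    have h := tendsto_finsetSum Finset.univ fun i (_ : i ∈ Finset.univ) =>
      tendsto_cauchyIntegral_cocompact ((Γ.smooth i).continuous_deriv le_rfl).continuousOn
        (Γ.smooth i).continuous.continuousOn
    rwa [Finset.sum_const_zero] at h
  have hne : ∀ᶠ z in cocompact ℂ, toSlice J z ∉ U := by
    filter_upwards [hlim.eventually_ne Complex.two_pi_I_ne_zero.symm] with z hz hzU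
    exact hz (Γ.winding_inside z hzU)
  rw [← Metric.cobounded_eq_cocompact, ← comap_norm_atTop, eventually_comap,
    eventually_atTop] at hne
  obtain ⟨R, hR⟩ := hne
  have hsub : closure U ⊆ Metric.closedBall 0 R := by
    refine closure_minimal (fun s hs => ?_) Metric.isClosed_closedBall
    obtain ⟨I, hI, z, rfl⟩ := hslice s hs
    rw [mem_closedBall_zero_iff, norm_toSlice hI]
    by_contra! hlt
    exact hR _ hlt.le z rfl (hax z I hI hs)
  filter_upwards [tendsto_norm_cocompact_atTop.eventually_gt_atTop R] with z hz hzU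
  have := hsub hzU
  rw [mem_closedBall_zero_iff, norm_toSlice hJ] at this
  exact hz.not_ge this

end Contour

theorem leftFC_Lq [OctBimodule Oct]
    (hlm : ∀ p x : Oct, lmo p x = p * x) (hrm : ∀ p x : Oct, rmo p x = x * p)
    {D : Set ℂ} {F : ℂ → ℂ} (hF : IsStem D F) {J : Oct} (hJ : J ∈ unitSphere)
    {I : Oct} (hI : I ∈ unitSphere) {w : ℂ}
    {U : Set Oct} (hU : LeftAdmissible (Oct.Lq (toSlice I w)) U) (hUD : closure U ⊆ OmegaD D)
    (Γ : SliceContour J U) :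
    leftFC (Oct.Lq (toSlice I w)) J Γ F = Oct.Lq (toSlice I (F w)) := by
  have hUopen : IsOpen (toSlice J ⁻¹' U) := hU.1.isOpen.preimage (continuous_toSlice J)
  have hwU : toSlice I w ∈ U := hU.2 (mem_pbSpec_Lq hrm _)
  have hwJ : toSlice J w ∈ U := hU.1.axially w I hI J hJ hwU
  have hwJ' : toSlice J (starRingEnd ℂ w) ∈ U := by
    refine hU.1.axially _ (-I) (neg_mem_unitSphere hI) J hJ ?_
    rwa [toSlice_neg]
  have hslice : ∀ s ∈ closure U, ∃ K ∈ unitSphere, ∃ z ∈ D, toSlice K z = s := fun s hs => by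
    simpa [OmegaD] using hUD hs
  have hclD : ∀ z, toSlice J z ∈ closure U → z ∈ D := by
    intro z hz
    obtain ⟨K, hK, v, hv, hvz⟩ := hslice _ hz
    rcases toSlice_eq_toSlice hK hJ hvz.symm with rfl | rfl
    exacts [hv, hF.conj_mem v hv]
  have hγD : ∀ i, ∀ t ∈ Set.Icc (0 : ℝ) 1, Γ.γ i t ∈ D := fun i t ht =>
    hclD _ (toSlice_mem_closure_of_contour Γ i ht)
  have hγne : ∀ z, toSlice J z ∈ U → ∀ i, ∀ t ∈ Set.Icc (0 : ℝ) 1, Γ.γ i t ≠ z := by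
    rintro z hz i t ht rfl
    exact (hUopen.frontier_eq ▸ mem_frontier_of_contour Γ i ht).2 hz
  have hcauchy : ∀ z, toSlice J z ∈ U →
      ∑ i, ∫ t in (0 : ℝ)..1, F (Γ.γ i t) * deriv (Γ.γ i) t / (Γ.γ i t - z) =
        F z * (2 * Real.pi * Complex.I) := by
    intro z hz
    rw [← Γ.winding_inside z hz]
    refine cauchy_integral_formula_cycle Γ.smooth hF.isOpen
      (E := (toSlice J ⁻¹' closure U)ᶜ)
      (isClosed_closure.preimage (continuous_toSlice J)).isOpen_compl ?_ hF.holo hγD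
      (fun i t ht h => h (toSlice_mem_closure_of_contour Γ i ht)) Γ.winding_outside ?_
      (hclD z (subset_closure hz)) (hγne z hz)
    · refine Set.eq_univ_of_forall fun v => ?_
      by_cases hv : toSlice J v ∈ closure U
      exacts [Or.inl (hclD v hv), Or.inr hv]
    · refine eventually_toSlice_notMem_closure hJ Γ
        (fun v K hK hv => hU.1.axially v K hK J hJ hv) fun s hs => ?_
      obtain ⟨K, hK, v, -, hv⟩ := hslice s (subset_closure hs)
      exact ⟨K, hK, v, hv.symm⟩
  have hpt : ∀ i, ∀ t ∈ Set.Icc (0 : ℝ) 1,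
      odotR (rinvR ((rmo (toSlice J (Γ.γ i t)) : Oct →L[ℝ] Oct) - Oct.Lq (toSlice I w)))
        ((-(toSlice J (deriv (Γ.γ i) t)) * J) * toSlice J (F (Γ.γ i t))) =
      slicePartOp I J (-Complex.I *
          (F (Γ.γ i t) * deriv (Γ.γ i) t / (Γ.γ i t - w))) +
        slicePartOp (-I) J (-Complex.I *
          (F (Γ.γ i t) * deriv (Γ.γ i) t / (Γ.γ i t - starRingEnd ℂ w))) := by
    intro i t ht
    have hds : (-(toSlice J (deriv (Γ.γ i) t)) * J) * toSlice J (F (Γ.γ i t)) =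
        toSlice J (-(deriv (Γ.γ i) t) * Complex.I * F (Γ.γ i t)) := by
      have hneg : -(toSlice J (deriv (Γ.γ i) t)) = toSlice J (-(deriv (Γ.γ i) t)) :=
        ((toSliceLin J).map_neg _).symm
      rw [hneg]
      conv_lhs => enter [1, 2]; rw [← toSlice_I J]
      rw [toSlice_mul hJ, toSlice_mul hJ]
    rw [hds, rinvR_rmo_sub_Lq hlm hrm hI hJ (hγne w hwJ i t ht) (hγne _ hwJ' i t ht),
      odotR_Lq hlm hrm, Oct.add_mul, slicePart_mul_toSlice I hJ, slicePart_mul_toSlice (-I) hJ,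
      Lq_add, ← slicePartOp_apply hlm, ← slicePartOp_apply hlm]
    congr 2 <;> ring
  have hii : ∀ z, toSlice J z ∈ U → ∀ i, IntervalIntegrable
      (fun t => -Complex.I * (F (Γ.γ i t) * deriv (Γ.γ i) t / (Γ.γ i t - z)))
      MeasureTheory.volume 0 1 := by
    intro z hz i
    refine ContinuousOn.intervalIntegrable ?_
    rw [Set.uIcc_of_le zero_le_one]
    have hc := (Γ.smooth i).continuous.continuousOn (s := Set.Icc (0 : ℝ) 1)
    exact continuousOn_const.mul (((hF.holo.continuousOn.comp hc (hγD i)).mul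
      ((Γ.smooth i).continuous_deriv le_rfl).continuousOn).div (hc.sub continuousOn_const)
        fun t ht => sub_ne_zero.2 (hγne z hz i t ht))
  have hpart : ∀ (K : Oct) (z : ℂ), toSlice J z ∈ U →
      ∑ i, ∫ t in (0 : ℝ)..1, slicePartOp K J (-Complex.I *
          (F (Γ.γ i t) * deriv (Γ.γ i) t / (Γ.γ i t - z))) =
        (2 * Real.pi) • slicePartOp K J (F z) := by
    intro K z hz
    simp only [ContinuousLinearMap.intervalIntegral_comp_comm _ (hii z hz _),
      intervalIntegral.integral_const_mul]
    rw [← map_sum, ← Finset.mul_sum, hcauchy z hz, ← map_smul]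
    congr 1
    rw [Complex.real_smul]
    push_cast
    linear_combination (-F z * (2 * Real.pi)) * Complex.I_mul_I
  have hsum : contourSum Γ (fun z dz =>
      odotR (rinvR ((rmo (toSlice J z) : Oct →L[ℝ] Oct) - Oct.Lq (toSlice I w)))
        ((-(toSlice J dz) * J) * toSlice J (F z))) =
      (2 * Real.pi) • Oct.Lq (toSlice I (F w)) := by
    rw [← slicePart_add_slicePart_neg_conj hI J (F w), Lq_add, smul_add, ← slicePartOp_apply hlm,
      ← slicePartOp_apply hlm, ← hF.conj_comm w (hclD w (subset_closure hwJ)),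
      ← hpart I w hwJ, ← hpart (-I) _ hwJ', ← Finset.sum_add_distrib]
    refine Finset.sum_congr rfl fun i _ => ?_
    rw [← intervalIntegral.integral_add]
    · refine intervalIntegral.integral_congr fun t ht => hpt i t ?_
      rwa [Set.uIcc_of_le zero_le_one] at ht
    · exact ⟨(slicePartOp I J).integrable_comp (hii w hwJ i).1,
        (slicePartOp I J).integrable_comp (hii w hwJ i).2⟩
    · exact ⟨(slicePartOp (-I) J).integrable_comp (hii _ hwJ' i).1,
        (slicePartOp (-I) J).integrable_comp (hii _ hwJ' i).2⟩
  rw [leftFC, hsum, smul_smul, inv_mul_cancel₀ Real.two_pi_pos.ne', one_smul]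

/-- Let `q ∈ 𝕆` be nonzero and `L_q : x ↦ qx` on the Banach `𝕆`-bimodule
`𝕆`.  For every `f` left slice regular on a set containing the closure of some
`L_q`-left-admissible domain — given by its decomposition `f = ∑_{i=0}^{7} f_{(i)} •^L e_i`
with slice preserving stems `Fc i` — and for every `J ∈ 𝕊`, the octonionic left slice
regular functional calculus gives `f*(L_q)_J = L_{f(q)}`, where, writing `q = x₀ + y₀ J_q`
(`J_q ∈ 𝕊`, i.e. `q = toSlice J_q z_q`), `f(q) = ∑_i toSlice J_q (Fc i z_q) · e_i`. -/
theorem statement_19 [OctBimodule Oct]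
    (hlm : ∀ p x : Oct, lmo p x = p * x) (hrm : ∀ p x : Oct, rmo p x = x * p)
    (q : Oct) (hq : q ≠ 0)
    (D : Set ℂ) (Fc : Fin 8 → ℂ → ℂ) (hFc : ∀ i, IsStem D (Fc i))
    (U : Set Oct) (hU : LeftAdmissible (Oct.Lq q) U) (hUD : closure U ⊆ OmegaD D)
    (J : Oct) (hJ : J ∈ unitSphere) (Γ : SliceContour J U)
    (Jq : Oct) (hJq : Jq ∈ unitSphere) (zq : ℂ) (hzq : q = Oct.toSlice Jq zq) :
    ∑ i : Fin 8, odotR (leftFC (Oct.Lq q) J Γ (Fc i)) (e i) =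
      Oct.Lq (∑ i : Fin 8, Oct.toSlice Jq (Fc i zq) * e i) := by
  subst hzq
  have h : ∀ i, odotR (leftFC (Oct.Lq (toSlice Jq zq)) J Γ (Fc i)) (e i) =
      OctBimodule.lm (toSlice Jq (Fc i zq) * e i) := fun i => by
    rw [leftFC_Lq hlm hrm (hFc i) hJ hJq hU hUD Γ, odotR_Lq hlm hrm, ← lmo_eq_Lq hlm]
    rfl
  rw [Finset.sum_congr rfl fun i _ => h i, ← map_sum, ← lmo_eq_Lq hlm]
  rfl
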